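/- Let 𝒞 be a set of cost functions that is closed under composition and consistent for unweighted resource graph games. Then for every c ∈ 𝒞 with c : ℤ_{≥0}^m → ℝ^m, for all pairwise distinct r, s, t ∈ {1,…,m} and all x ∈ ℤ_{≥0}^m with x_r > 0, it holds that c_r(x + 1_s) − c_r(x) = c_r(x + 1_{{s,t}}) − c_r(x + 1_t). -/

import Mathlib

open Finset

/-- The indicator vector of a set `S` of resources. -/
def indicVec {m : ℕ} (S : Finset (Fin m)) : Fin m → ℕ :=
  fun r => if r ∈ S then 1 else 0

/-- The load vector induced by a strategy profile `x`. -/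
def loadVec {n m : ℕ} (x : Fin n → Fin m → ℕ) : Fin m → ℕ :=
  fun r => ∑ i, x i r

/-- The private cost of player `i` in profile `x` with cost function `c`. -/
def playerCost {n m : ℕ} (c : (Fin m → ℕ) → Fin m → ℝ)
    (x : Fin n → Fin m → ℕ) (i : Fin n) : ℝ :=
  ∑ r, (x i r : ℝ) * c (loadVec x) r

/-- `X` is a valid system of strategy sets for an unweighted resource graph game:
each `X i` is a nonempty finite set of `0/1`-vectors. -/
def IsStrategySets {n m : ℕ} (X : Fin n → Finset (Fin m → ℕ)) : Prop :=
  (∀ i, (X i).Nonempty) ∧ ∀ i, ∀ v ∈ X i, ∀ r, v r ≤ 1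

/-- `x` is a pure Nash equilibrium of the unweighted resource graph game with
strategy sets `X` and cost function `c`. -/
def IsPNE {n m : ℕ} (c : (Fin m → ℕ) → Fin m → ℝ)
    (X : Fin n → Finset (Fin m → ℕ)) (x : Fin n → Fin m → ℕ) : Prop :=
  (∀ i, x i ∈ X i) ∧
    ∀ i, ∀ y ∈ X i, playerCost c x i ≤ playerCost c (Function.update x i y) i

/-- The composition `c ⊕ c'` of two cost functions. -/
def oplus {m m' : ℕ} (c : (Fin m → ℕ) → Fin m → ℝ)
    (c' : (Fin m' → ℕ) → Fin m' → ℝ) :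
    (Fin (m + m') → ℕ) → Fin (m + m') → ℝ :=
  fun x => Fin.addCases (motive := fun _ => ℝ)
    (fun i => c (fun j => x (Fin.castAdd m' j)) i)
    (fun i => c' (fun j => x (Fin.natAdd m j)) i)

/-- A set of cost functions, one set for each number `m` of resources. -/
abbrev CostFamily := (m : ℕ) → Set ((Fin m → ℕ) → Fin m → ℝ)

/-- `𝒞` is closed under composition. -/
def ClosedUnderComposition (𝒞 : CostFamily) : Prop :=
  ∀ m m' : ℕ, ∀ c ∈ 𝒞 m, ∀ c' ∈ 𝒞 m', oplus c c' ∈ 𝒞 (m + m')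

/-- `𝒞` is consistent for unweighted resource graph games: every unweighted
resource graph game whose cost function belongs to `𝒞` has a pure Nash equilibrium. -/
def Consistent (𝒞 : CostFamily) : Prop :=
  ∀ m : ℕ, ∀ c ∈ 𝒞 m, ∀ n : ℕ, ∀ X : Fin n → Finset (Fin m → ℕ),
    IsStrategySets X → ∃ x, IsPNE c X x

/-- The cost of a player using `a` when another player uses `b` and all remaining players
together contribute the load `z`. -/
def pairCost {m : ℕ} (c : (Fin m → ℕ) → Fin m → ℝ) (z a b : Fin m → ℕ) : ℝ :=
  ∑ r, (a r : ℝ) * c (z + a + b) r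

theorem pairCost_oplus {m m' : ℕ} (c : (Fin m → ℕ) → Fin m → ℝ)
    (c' : (Fin m' → ℕ) → Fin m' → ℝ) (z a b : Fin m → ℕ) (z' a' b' : Fin m' → ℕ) :
    pairCost (oplus c c') (Fin.append z z') (Fin.append a a') (Fin.append b b')
      = pairCost c z a b + pairCost c' z' a' b' := by
  simp only [pairCost, Fin.sum_univ_add, oplus, Pi.add_apply, Fin.append_left, Fin.append_right,
    Fin.addCases_left, Fin.addCases_right]
  rfl

theorem append_le_one {m m' : ℕ} {a : Fin m → ℕ} {a' : Fin m' → ℕ}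
    (ha : ∀ r, a r ≤ 1) (ha' : ∀ r, a' r ≤ 1) (r : Fin (m + m')) : Fin.append a a' r ≤ 1 := by
  refine Fin.addCases (fun i => ?_) (fun i => ?_) r
  · simpa using ha i
  · simpa using ha' i

/-- Every load vector is induced by finitely many players with one `0/1`-strategy each. -/
theorem exists_loadVec_eq {m : ℕ} (z : Fin m → ℕ) :
    ∃ (k : ℕ) (f : Fin k → Fin m → ℕ), (∀ j r, f j r ≤ 1) ∧ loadVec f = z := by
  refine ⟨∑ r, z r, fun j r => if (j : ℕ) < z r then 1 else 0, fun j r => ?_, ?_⟩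
  · dsimp only
    split_ifs <;> simp
  · funext r
    have hr : z r ≤ ∑ r, z r := single_le_sum (fun _ _ => Nat.zero_le _) (mem_univ r)
    simp only [loadVec, sum_boole, Fin.card_filter_val_lt, Nat.cast_id]
    exact min_eq_right hr

theorem loadVec_cons_cons {k m : ℕ} (a b : Fin m → ℕ) (f : Fin k → Fin m → ℕ) :
    loadVec (Fin.cons a (Fin.cons b f : Fin (k + 1) → Fin m → ℕ) : Fin (k + 2) → Fin m → ℕ)
      = loadVec f + a + b := by
  funext r
  simp only [loadVec, Fin.sum_univ_succ, Fin.cons_zero, Fin.cons_succ, Pi.add_apply]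
  omega

/-- A consistent cost function yields equilibria in games with two players, each having two
strategies, on top of an arbitrary fixed load `z`. -/
theorem Consistent.exists_pair {𝒞 : CostFamily} (hcons : Consistent 𝒞) {m : ℕ}
    {c : (Fin m → ℕ) → Fin m → ℝ} (hc : c ∈ 𝒞 m) (z a a' b b' : Fin m → ℕ)
    (ha : ∀ r, a r ≤ 1) (ha' : ∀ r, a' r ≤ 1) (hb : ∀ r, b r ≤ 1) (hb' : ∀ r, b' r ≤ 1) :
    ∃ p q : Fin m → ℕ, (p = a ∨ p = a') ∧ (q = b ∨ q = b') ∧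
      (pairCost c z p q ≤ pairCost c z a q ∧ pairCost c z p q ≤ pairCost c z a' q) ∧
      (pairCost c z q p ≤ pairCost c z b p ∧ pairCost c z q p ≤ pairCost c z b' p) := by
  obtain ⟨k, f, hf, rfl⟩ := exists_loadVec_eq z
  let X : Fin (k + 2) → Finset (Fin m → ℕ) :=
    Fin.cons {a, a'} (Fin.cons {b, b'} fun j => {f j} : Fin (k + 1) → Finset (Fin m → ℕ))
  have hX : IsStrategySets X := by
    constructor
    · refine Fin.cases ?_ (Fin.cases ?_ fun j => ?_) <;> simp [X]
    · refine Fin.cases ?_ (Fin.cases ?_ fun j => ?_)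
      · simpa [X] using ⟨ha, ha'⟩
      · simpa [X] using ⟨hb, hb'⟩
      · simpa [X] using hf j
  obtain ⟨x, hxX, hx⟩ := hcons m c hc (k + 2) X hX
  have hxe : x = Fin.cons (x 0) (Fin.cons (x 1) f : Fin (k + 1) → Fin m → ℕ) := by
    funext i
    refine Fin.cases rfl (Fin.cases rfl fun j => ?_) i
    simpa [X] using hxX j.succ.succ
  generalize hp : x 0 = p at hxe
  generalize hq : x 1 = q at hxe
  have hp' : p = a ∨ p = a' := by simpa [X, hp] using hxX 0
  have hq' : q = b ∨ q = b' := by simpa [X, ← hq] using hxX (Fin.succ 0)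
  have cost_fst (u v : Fin m → ℕ) :
      playerCost c (Fin.cons u (Fin.cons v f : Fin (k + 1) → Fin m → ℕ)) 0
        = pairCost c (loadVec f) u v := by
    simp only [playerCost, loadVec_cons_cons, pairCost, Fin.cons_zero]
  have cost_snd (u v : Fin m → ℕ) :
      playerCost c (Fin.cons u (Fin.cons v f : Fin (k + 1) → Fin m → ℕ)) (Fin.succ 0)
        = pairCost c (loadVec f) v u := by
    simp only [playerCost, loadVec_cons_cons, pairCost, Fin.cons_zero, Fin.cons_succ,
      add_right_comm]
  have dev_fst (y : Fin m → ℕ) (hy : y ∈ X 0) :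
      pairCost c (loadVec f) p q ≤ pairCost c (loadVec f) y q := by
    have := hx 0 y hy
    rwa [hxe, Fin.update_cons_zero, cost_fst, cost_fst] at this
  have dev_snd (y : Fin m → ℕ) (hy : y ∈ X (Fin.succ 0)) :
      pairCost c (loadVec f) q p ≤ pairCost c (loadVec f) y p := by
    have := hx (Fin.succ 0) y hy
    rwa [hxe, ← Fin.cons_update, Fin.update_cons_zero, cost_snd, cost_snd] at this
  exact ⟨p, q, hp', hq', ⟨dev_fst a (by simp [X]), dev_fst a' (by simp [X])⟩,
    dev_snd b (by simp [X]), dev_snd b' (by simp [X])⟩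

/-- Two-player games with costs in a consistent, composition-closed family satisfy the
four-cycle condition characterizing exact potential games. -/
theorem Consistent.pairCost_cycle {𝒞 : CostFamily} (hcons : Consistent 𝒞)
    (hcomp : ClosedUnderComposition 𝒞) {m : ℕ}
    {c : (Fin m → ℕ) → Fin m → ℝ} (hc : c ∈ 𝒞 m) (z a a' b b' : Fin m → ℕ)
    (ha : ∀ r, a r ≤ 1) (ha' : ∀ r, a' r ≤ 1) (hb : ∀ r, b r ≤ 1) (hb' : ∀ r, b' r ≤ 1) :
    (pairCost c z a' b - pairCost c z a b) - (pairCost c z a' b' - pairCost c z a b')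
      = (pairCost c z b' a - pairCost c z b a) - (pairCost c z b' a' - pairCost c z b a') := by
  have hcc := hcomp m m c hc c hc
  obtain ⟨p, q, hp, hq, hpq, hqp⟩ := hcons.exists_pair (hcomp _ _ _ hcc _ hcc)
    (Fin.append (Fin.append z z) (Fin.append z z))
    (Fin.append (Fin.append a a') (Fin.append b' b))
    (Fin.append (Fin.append a' a) (Fin.append b b'))
    (Fin.append (Fin.append b b') (Fin.append a a'))
    (Fin.append (Fin.append b' b) (Fin.append a' a))
    (append_le_one (append_le_one ha ha') (append_le_one hb' hb))
    (append_le_one (append_le_one ha' ha) (append_le_one hb hb'))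
    (append_le_one (append_le_one hb hb') (append_le_one ha ha'))
    (append_le_one (append_le_one hb' hb) (append_le_one ha' ha))
  rcases hp with rfl | rfl <;> rcases hq with rfl | rfl <;>
    simp only [pairCost_oplus] at hpq hqp <;> linarith [hpq.1, hpq.2, hqp.1, hqp.2]

theorem indicVec_le_one {m : ℕ} (S : Finset (Fin m)) (r : Fin m) : indicVec S r ≤ 1 := by
  unfold indicVec
  split_ifs <;> simp

theorem indicVec_insert {m : ℕ} {S : Finset (Fin m)} {r : Fin m} (hr : r ∉ S) :
    indicVec (insert r S) = indicVec {r} + indicVec S := by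
  funext q
  by_cases hq : q = r
  · subst hq
    simp [indicVec, hr]
  · simp [indicVec, hq]

theorem pairCost_indicVec {m : ℕ} (c : (Fin m → ℕ) → Fin m → ℝ) (z b : Fin m → ℕ)
    (S : Finset (Fin m)) :
    pairCost c z (indicVec S) b = ∑ r ∈ S, c (z + indicVec S + b) r := by
  simp [pairCost, indicVec]

/-- Lemma: for consistent, composition-closed sets of cost functions, the effect of
resource `s` on resource `r` does not depend on the load of a third resource `t`. -/
theorem hesse_mixed_unweighted (𝒞 : CostFamily)
    (hcomp : ClosedUnderComposition 𝒞) (hcons : Consistent 𝒞)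
    (m : ℕ) (c : (Fin m → ℕ) → Fin m → ℝ) (hc : c ∈ 𝒞 m)
    (r s t : Fin m) (hrs : r ≠ s) (hrt : r ≠ t) (hst : s ≠ t)
    (x : Fin m → ℕ) (hx : 0 < x r) :
    c (x + indicVec {s}) r - c x r
      = c (x + indicVec {s, t}) r - c (x + indicVec {t}) r := by
  have le_one := fun S : Finset (Fin m) => indicVec_le_one S
  obtain ⟨z, rfl⟩ : ∃ z, x = z + indicVec {r} := by
    refine ⟨x - indicVec {r}, (tsub_add_cancel_of_le fun q => ?_).symm⟩
    by_cases hq : q = r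
    · subst hq
      simpa [indicVec] using Nat.succ_le_of_lt hx
    · simp [indicVec, hq]
  have cycle_rs := hcons.pairCost_cycle hcomp hc z (indicVec {r}) (indicVec {r, s})
    (indicVec ∅) (indicVec {t}) (le_one _) (le_one _) (le_one _) (le_one _)
  have cycle_s := hcons.pairCost_cycle hcomp hc (z + indicVec {r}) (indicVec ∅) (indicVec {s})
    (indicVec ∅) (indicVec {t}) (le_one _) (le_one _) (le_one _) (le_one _)
  have hempty : indicVec (∅ : Finset (Fin m)) = 0 := by
    funext q
    simp [indicVec]
  simp only [pairCost_indicVec, sum_singleton, sum_empty, sum_pair hrs] at cycle_rs cycle_s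
  simp only [indicVec_insert (show r ∉ ({s} : Finset (Fin m)) by simpa using hrs),
    hempty, add_zero] at cycle_rs cycle_s
  rw [indicVec_insert (show s ∉ ({t} : Finset (Fin m)) by simpa using hst)]
  simp only [← add_assoc, add_right_comm _ (indicVec {t}) _] at cycle_rs cycle_s ⊢
  linarith
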